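/- Let p(z,w) = −(4 + z + 1/z + w + 1/w) be the characteristic polynomial of the toroidal dimer model on the overlaid bipartite graph of the infinite square weave 𝒲. Then 2π · m(p) = 2·v_oct, where v_oct = 8Λ(π/4) is the hyperbolic volume of the regular ideal octahedron expressed via the Lobachevsky function; equivalently, ∫₀^{2π} ∫₀^{2π} log (4 + 2 cos s + 2 cos t) ds dt = −32π ∫₀^{π/4} log |2 sin u| du. -/

import Mathlib

open Real

/-- The integral form of the logarithmic Mahler measure of `z + 1/z + 2 * cosh (2 * y)`. -/
lemma integral_log_two_mul_cosh_add_two_mul_cos {y : ℝ} (hy : 0 ≤ y) :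
    ∫ t in (0:ℝ)..(2*π), log (2 * cosh (2 * y) + 2 * cos t) = 4 * π * y := by
  have hpt : ∀ t : ℝ, log (2 * cosh (2 * y) + 2 * cos t)
      = 2 * log ‖circleMap 0 1 t + (exp (2 * y) : ℂ)‖ - 2 * y := by
    intro t
    have hexp : exp (2 * y) * exp (-(2 * y)) = 1 := by rw [← exp_add]; simp
    have hsq : ‖circleMap 0 1 t + (exp (2 * y) : ℂ)‖ ^ 2
        = exp (2 * y) * (2 * cosh (2 * y) + 2 * cos t) := by
      rw [← Complex.normSq_eq_norm_sq, Complex.normSq_apply, cosh_eq]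
      simp [circleMap, Complex.exp_ofReal_mul_I_re, Complex.exp_ofReal_mul_I_im,
        -Complex.ofReal_exp, -Complex.ofReal_mul]
      linear_combination (sin_sq_add_cos_sq t) - hexp
    by_cases h0 : 2 * cosh (2 * y) + 2 * cos t = 0
    · have h1 : 2 * y = 0 := by
        by_contra h
        have := one_lt_cosh.2 h
        linarith [neg_one_le_cos t]
      rw [h0, mul_zero, sq_eq_zero_iff] at hsq
      rw [hsq, h0, h1]
      simp
    · have h2 : log (‖circleMap 0 1 t + (exp (2 * y) : ℂ)‖ ^ 2)
          = 2 * y + log (2 * cosh (2 * y) + 2 * cos t) := by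
        rw [hsq, log_mul (exp_pos _).ne' h0, log_exp]
      rw [log_pow] at h2
      push_cast at h2 ⊢
      linarith
  have havg := circleAverage_log_norm_add_const_eq_posLog (a := (exp (2 * y) : ℂ))
  rw [circleAverage_def, Complex.norm_real, norm_of_nonneg (exp_pos _).le,
    posLog_eq_log (by rw [abs_of_pos (exp_pos _)]; exact one_le_exp (by linarith)), log_exp,
    smul_eq_mul, inv_mul_eq_iff_eq_mul₀ (by positivity)] at havg
  have hint := circleIntegrable_log_norm_sub_const (c := 0) (a := -(exp (2 * y) : ℂ)) 1
  simp only [sub_neg_eq_add] at hint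
  simp_rw [hpt]
  rw [intervalIntegral.integral_sub (hint.const_mul 2) intervalIntegrable_const,
    intervalIntegral.integral_const_mul, havg, intervalIntegral.integral_const]
  simp only [smul_eq_mul]
  ring

lemma integral_log_four_add_two_mul_cos_add_two_mul_cos (s : ℝ) :
    ∫ t in (0:ℝ)..(2*π), log (4 + 2 * cos s + 2 * cos t) = 4 * π * arsinh |cos (s / 2)| := by
  rw [← integral_log_two_mul_cosh_add_two_mul_cos (arsinh_nonneg_iff.2 (abs_nonneg _)),
    cosh_two_mul, cosh_sq, sinh_arsinh, sq_abs, cos_sq, mul_div_cancel₀ s two_ne_zero]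
  ring_nf

lemma integral_comp_abs_cos_half {f : ℝ → ℝ} (hf : Continuous f) :
    ∫ s in (0:ℝ)..(2*π), f |cos (s / 2)| = 4 * ∫ x in (0:ℝ)..(π/2), f (sin x) := by
  have hfirst : ∫ x in (0:ℝ)..(π/2), f |cos x| = ∫ x in (0:ℝ)..(π/2), f |sin x| := by
    have := intervalIntegral.integral_comp_sub_left (a := 0) (b := π/2)
      (fun x => f |cos x|) (π/2)
    simpa [cos_pi_div_two_sub] using this.symm
  have hsecond : ∫ x in (π/2)..π, f |cos x| = ∫ x in (0:ℝ)..(π/2), f |sin x| := by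
    have := intervalIntegral.integral_comp_add_right (a := 0) (b := π/2)
      (fun x => f |cos x|) (π/2)
    simpa [cos_add_pi_div_two] using this.symm
  have hsin : ∫ x in (0:ℝ)..(π/2), f |sin x| = ∫ x in (0:ℝ)..(π/2), f (sin x) := by
    refine intervalIntegral.integral_congr fun x hx => ?_
    rw [Set.uIcc_of_le (by positivity)] at hx
    simp only [abs_of_nonneg (sin_nonneg_of_nonneg_of_le_pi hx.1 (by linarith [hx.2, pi_pos]))]
  have hcont : Continuous fun x => f |cos x| := by fun_prop
  rw [intervalIntegral.integral_comp_div (fun x => f |cos x|) two_ne_zero, zero_div,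
    mul_div_cancel_left₀ π two_ne_zero,
    ← intervalIntegral.integral_add_adjacent_intervals (b := π/2)
      (hcont.intervalIntegrable _ _) (hcont.intervalIntegrable _ _), hfirst, hsecond, hsin,
    smul_eq_mul]
  ring

lemma integral_sin_mul_inv_sqrt_one_add_sq {b : ℝ} (hb : 0 < b) :
    ∫ θ in (0:ℝ)..(π/2), (√(1 + (b * sin θ) ^ 2))⁻¹ * sin θ = arctan b / b := by
  have hderiv : ∀ θ : ℝ, HasDerivAt (fun θ => -(arcsin (b / √(1 + b ^ 2) * cos θ) / b))
      ((√(1 + (b * sin θ) ^ 2))⁻¹ * sin θ) θ := by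
    intro θ
    have hs : 0 < √(1 + b ^ 2) := by positivity
    have hss : √(1 + b ^ 2) ^ 2 = 1 + b ^ 2 := sq_sqrt (by positivity)
    have hone : 1 - (b / √(1 + b ^ 2) * cos θ) ^ 2
        = (1 + (b * sin θ) ^ 2) / √(1 + b ^ 2) ^ 2 := by
      rw [mul_pow, div_pow, hss, mul_pow, sin_sq]
      field_simp
      ring
    have hpos : 0 < 1 - (b / √(1 + b ^ 2) * cos θ) ^ 2 := by rw [hone]; positivity
    have habs := abs_lt.1 (sq_lt_one_iff_abs_lt_one _ |>.1 (sub_pos.1 hpos))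
    have h := ((hasDerivAt_arcsin habs.1.ne' habs.2.ne).comp θ
      ((hasDerivAt_cos θ).const_mul (b / √(1 + b ^ 2)))).div_const b |>.neg
    refine h.congr_deriv ?_
    rw [hone, sqrt_div' _ (by positivity), sqrt_sq hs.le]
    have : 0 < √(1 + (b * sin θ) ^ 2) := by positivity
    field_simp
  rw [intervalIntegral.integral_eq_sub_of_hasDerivAt (fun θ _ => hderiv θ)]
  · simp [arctan_eq_arcsin]
  · refine Continuous.intervalIntegrable ?_ _ _
    exact (Continuous.inv₀ (by fun_prop) fun θ => by positivity).mul continuous_sin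

lemma hasDerivAt_integral_arsinh_mul_sin (b : ℝ) :
    HasDerivAt (fun b => ∫ θ in (0:ℝ)..(π/2), arsinh (b * sin θ))
      (∫ θ in (0:ℝ)..(π/2), (√(1 + (b * sin θ) ^ 2))⁻¹ * sin θ) b := by
  refine (intervalIntegral.hasDerivAt_integral_of_dominated_loc_of_deriv_le
    (F := fun b θ => arsinh (b * sin θ)) (F' := fun b θ => (√(1 + (b * sin θ) ^ 2))⁻¹ * sin θ)
    (bound := fun _ => 1) Filter.univ_mem ?_ ?_ ?_ ?_ intervalIntegrable_const ?_).2
  · exact .of_forall fun b => (continuous_arsinh.comp (by fun_prop)).aestronglyMeasurable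
  · exact (continuous_arsinh.comp (by fun_prop)).intervalIntegrable _ _
  · exact ((Continuous.inv₀ (by fun_prop) fun θ => by positivity).mul
      continuous_sin).aestronglyMeasurable
  · refine .of_forall fun θ _ b _ => ?_
    rw [norm_mul, norm_inv, norm_of_nonneg (sqrt_nonneg _)]
    refine mul_le_one₀ (inv_le_one_of_one_le₀ ?_) (norm_nonneg _) (abs_sin_le_one θ)
    exact one_le_sqrt.2 (by nlinarith [sq_nonneg (b * sin θ)])
  · refine .of_forall fun θ _ b _ => ?_
    simpa using (((hasDerivAt_id b).mul_const (sin θ)).arsinh)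

lemma continuousOn_mul_log_sin : ContinuousOn (fun u => u * log (sin u)) (Set.Ico 0 π) := by
  intro u hu
  rcases hu.1.eq_or_lt with rfl | hpos
  · have hlim : Filter.Tendsto (fun u => π / 2 * |sin u * log (sin u)|)
        (nhdsWithin 0 (Set.Ico 0 π)) (nhds 0) := by
      have : Continuous fun u => π / 2 * |sin u * log (sin u)| :=
        continuous_const.mul (continuous_mul_log.comp continuous_sin).abs
      simpa using (this.tendsto 0).mono_left nhdsWithin_le_nhds
    have hsmall : ∀ᶠ u in nhdsWithin (0:ℝ) (Set.Ico 0 π), u ∈ Set.Icc 0 (π / 2) := by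
      filter_upwards [self_mem_nhdsWithin,
        mem_nhdsWithin_of_mem_nhds (Iic_mem_nhds (pi_div_two_pos))] with v hv hv'
      exact ⟨hv.1, hv'⟩
    rw [ContinuousWithinAt, zero_mul]
    refine squeeze_zero_norm' ?_ hlim
    filter_upwards [hsmall] with v hv
    have h := mul_le_sin hv.1 hv.2
    have h' : v ≤ π / 2 * sin v := by
      calc v = π / 2 * (2 / π * v) := by field_simp
        _ ≤ _ := by gcongr
    have hsv := sin_nonneg_of_nonneg_of_le_pi hv.1 (by linarith [hv.2, pi_pos])
    rw [norm_mul, norm_of_nonneg hv.1, abs_mul, abs_of_nonneg hsv, ← mul_assoc]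
    exact mul_le_mul_of_nonneg_right h' (norm_nonneg _)
  · exact (continuousAt_id.mul (continuous_sin.continuousAt.log
      (sin_pos_of_pos_of_lt_pi hpos hu.2).ne')).continuousWithinAt

lemma integral_arsinh_sin :
    ∫ θ in (0:ℝ)..(π/2), arsinh (sin θ)
      = -∫ u in (0:ℝ)..(π/4), (log (sin u) - log (cos u)) := by
  have hcos : ∀ u ∈ Set.Icc 0 (π/4), 0 < cos u := fun u hu =>
    cos_pos_of_mem_Ioo ⟨by linarith [hu.1, pi_pos], by linarith [hu.2, pi_pos]⟩
  have hcont : ContinuousOn (fun u => (∫ θ in (0:ℝ)..(π/2), arsinh (tan u * sin θ))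
      - (u * log (sin u) - u * log (cos u))) (Set.Icc 0 (π/4)) := by
    refine ContinuousOn.sub ?_ (ContinuousOn.sub ?_ ?_)
    · intro u hu
      exact (ContinuousAt.comp (f := tan) (hasDerivAt_integral_arsinh_mul_sin _).continuousAt
        (continuousAt_tan.2 (hcos u hu).ne')).continuousWithinAt
    · exact continuousOn_mul_log_sin.mono fun u hu => ⟨hu.1, by linarith [hu.2, pi_pos]⟩
    · exact continuousOn_id.mul (continuous_cos.continuousOn.log fun u hu => (hcos u hu).ne')
  have hderiv : ∀ u ∈ Set.Ioo 0 (π/4),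
      HasDerivAt (fun u => (∫ θ in (0:ℝ)..(π/2), arsinh (tan u * sin θ))
        - (u * log (sin u) - u * log (cos u))) (-(log (sin u) - log (cos u))) u := by
    intro u hu
    have hc := hcos u ⟨hu.1.le, hu.2.le⟩
    have hs : 0 < sin u := sin_pos_of_pos_of_lt_pi hu.1 (by linarith [hu.2, pi_pos])
    have ht : 0 < tan u := by rw [tan_eq_sin_div_cos]; positivity
    have hI := hasDerivAt_integral_arsinh_mul_sin (tan u)
    rw [integral_sin_mul_inv_sqrt_one_add_sq ht,
      arctan_tan (by linarith [hu.1, pi_pos]) (by linarith [hu.2, pi_pos])] at hI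
    have h := (hI.comp u (hasDerivAt_tan hc.ne')).sub
      (((hasDerivAt_id u).mul ((hasDerivAt_sin u).log hs.ne')).sub
        ((hasDerivAt_id u).mul ((hasDerivAt_cos u).log hc.ne')))
    refine h.congr_deriv ?_
    simp only [id, tan_eq_sin_div_cos]
    field_simp
    linear_combination (-u) * sin_sq_add_cos_sq u
  have hint : IntervalIntegrable (fun u => -(log (sin u) - log (cos u))) MeasureTheory.volume
      0 (π/4) := (intervalIntegrable_log_sin.sub intervalIntegrable_log_cos).neg
  have hftc := intervalIntegral.integral_eq_sub_of_hasDerivAt_of_le (by positivity)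
    hcont hderiv hint
  rw [intervalIntegral.integral_neg] at hftc
  rw [hftc]
  simp [cos_pi_div_four, sin_pi_div_four]

lemma integral_log_sin_sub_log_cos :
    ∫ u in (0:ℝ)..(π/4), (log (sin u) - log (cos u))
      = 2 * ∫ u in (0:ℝ)..(π/4), log |2 * sin u| := by
  have hlog : ∫ u in (0:ℝ)..(π/4), log |2 * sin u|
      = ∫ u in (0:ℝ)..(π/4), (log 2 + log (sin u)) := by
    refine intervalIntegral.integral_congr_ae (.of_forall fun u hu => ?_)
    rw [Set.uIoc_of_le (by positivity)] at hu
    have hs : 0 < sin u := sin_pos_of_pos_of_lt_pi hu.1 (by linarith [hu.2, pi_pos])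
    rw [log_abs, log_mul two_ne_zero hs.ne']
  have hcos : ∫ u in (0:ℝ)..(π/4), log (cos u) = ∫ u in (π/4)..(π/2), log (sin u) := by
    have := intervalIntegral.integral_comp_sub_left (a := 0) (b := π/4)
      (fun x => log (sin x)) (π/2)
    simp only [sin_pi_div_two_sub, sub_zero] at this
    rw [this]
    congr 1
    ring
  have hsin : ∀ a b : ℝ, IntervalIntegrable (fun u => log (sin u)) MeasureTheory.volume a b :=
    fun a b => intervalIntegrable_log_sin
  have hadd := intervalIntegral.integral_add_adjacent_intervals (hsin 0 (π/4)) (hsin (π/4) (π/2))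
  rw [integral_log_sin_zero_pi_div_two] at hadd
  rw [hlog, intervalIntegral.integral_add intervalIntegrable_const (hsin _ _),
    intervalIntegral.integral_sub (g := fun u => log (cos u)) (hsin _ _)
      intervalIntegrable_log_cos, hcos,
    intervalIntegral.integral_const, smul_eq_mul]
  linarith

/-- For the characteristic polynomial `p(z,w) = −(4 + z + 1/z + w + 1/w)` of the
toroidal dimer model for the square weave, `2π · m(p) = 2 v_oct`, where
`v_oct = 8Λ(π/4)` and `Λ(θ) = −∫₀^θ log|2 sin u| du`; equivalently
`∫₀^{2π}∫₀^{2π} log(4 + 2 cos s + 2 cos t) ds dt = −32π ∫₀^{π/4} log|2 sin u| du`. -/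
theorem mahler_square_weave_eq_two_voct :
    (∫ s in (0:ℝ)..(2*π), ∫ t in (0:ℝ)..(2*π),
        Real.log (4 + 2 * Real.cos s + 2 * Real.cos t))
      = -32 * π * ∫ u in (0:ℝ)..(π/4), Real.log |2 * Real.sin u| := by
  simp_rw [integral_log_four_add_two_mul_cos_add_two_mul_cos]
  rw [intervalIntegral.integral_const_mul, integral_comp_abs_cos_half continuous_arsinh,
    integral_arsinh_sin, integral_log_sin_sub_log_cos]
  ring
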